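/- Let a, b, c be integers with a ≠ 0, set ζ = b^3 − 4abc, and let f : ℝ^2 → ℂ be a smooth compactly supported function with Fourier transform f̂(ξ,η) = ∫∫ f(x,y) e^{−2πi(xξ + yη)} dx dy. Then Σ_{(m,n) ∈ Λ_{(a,b,c)}} f(m,n) = Σ_{(α,β) ∈ ℤ^2} ψ̂(α,β) · f̂(α/(96a^3), β/(12a)), where ψ̂(α,β) = (1/(8a^2 · 12a · 12a)) Σ_{k=0}^{12|a|−1} e^{2πi α (ζ + 8a^2 k)/(96a^3)} e^{2πi β (c^2 − 3bk)/(12a)}, and the sum on the right-hand side converges absolutely. -/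

import Mathlib

open MeasureTheory

/-- The lattice set `Λ_{(a,b,c)} ⊆ ℤ²`. -/
def Lam (a b c : ℤ) : Set (ℤ × ℤ) :=
  {p : ℤ × ℤ | 8 * a ^ 2 ∣ p.1 - (b ^ 3 - 4 * a * b * c) ∧
    12 * a ∣ p.2 + 3 * b * ((p.1 - b ^ 3 + 4 * a * b * c) / (8 * a ^ 2)) - c ^ 2}

/-- The Fourier transform of `f : ℝ² → ℂ`. -/
noncomputable def fourier2 (f : ℝ × ℝ → ℂ) (ξ η : ℝ) : ℂ :=
  ∫ x : ℝ, ∫ y : ℝ,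
    f (x, y) * Complex.exp (-(2 * Real.pi * Complex.I * ((x : ℂ) * (ξ : ℂ) + (y : ℂ) * (η : ℂ))))

/-- The Fourier coefficient `ψ̂(α,β)` of the characteristic function of `Λ_{(a,b,c)}`. -/
noncomputable def psihat (a b c : ℤ) (α β : ℤ) : ℂ :=
  1 / (8 * (a : ℂ) ^ 2 * (12 * (a : ℂ)) * (12 * (a : ℂ))) *
    ∑ k ∈ Finset.range (12 * a.natAbs),
      Complex.exp (2 * Real.pi * Complex.I * (α : ℂ) *
          (((b ^ 3 - 4 * a * b * c : ℤ) : ℂ) + 8 * (a : ℂ) ^ 2 * (k : ℂ)) / (96 * (a : ℂ) ^ 3)) *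
        Complex.exp (2 * Real.pi * Complex.I * (β : ℂ) *
          ((c : ℂ) ^ 2 - 3 * (b : ℂ) * (k : ℂ)) / (12 * (a : ℂ)))

open scoped FourierTransform

lemma aux_fourier2_eq (f : ℝ × ℝ → ℂ) (ξ η : ℝ) :
    fourier2 f ξ η = 𝓕 (fun x : ℝ => 𝓕 (fun y : ℝ => f (x, y)) η) ξ := by
  unfold fourier2
  rw [Real.fourier_real_eq_integral_exp_smul]
  congr 1; ext x
  rw [Real.fourier_real_eq_integral_exp_smul, ← integral_smul]
  congr 1; ext y
  rw [smul_smul, ← Complex.exp_add, smul_eq_mul, mul_comm]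
  congr 2
  push_cast; ring

lemma aux_slice_y {f : ℝ × ℝ → ℂ} (hs : HasCompactSupport f) (x : ℝ) :
    HasCompactSupport (fun y : ℝ => f (x, y)) := by
  have : Topology.IsClosedEmbedding (fun y : ℝ => ((x, y) : ℝ × ℝ)) := by
    refine Topology.IsClosedEmbedding.of_continuous_injective_isClosedMap (by fun_prop) ?_ ?_
    · intro y z h; simpa using h
    · exact isClosedMap_prodMk_left x
  exact hs.comp_isClosedEmbedding this

lemma aux_swap (f : ℝ × ℝ → ℂ) (hf : Continuous f) (hs : HasCompactSupport f) (ξ η : ℝ) :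
    fourier2 (fun p => f p.swap) η ξ = fourier2 f ξ η := by
  unfold fourier2
  rw [integral_integral_swap_of_hasCompactSupport]
  · congr 1; ext x; congr 1; ext y
    simp only [Prod.swap_prod_mk]
    congr 3; ring
  · unfold Function.uncurry
    fun_prop
  · have : HasCompactSupport (fun p : ℝ × ℝ => f p.swap) :=
      hs.comp_homeomorph (Homeomorph.prodComm ℝ ℝ)
    exact this.mul_right

lemma aux_Dy (f : ℝ × ℝ → ℂ) (hf : ContDiff ℝ (⊤ : ℕ∞) f) (hs : HasCompactSupport f) (ξ η : ℝ) :
    fourier2 (fun p => fderiv ℝ f p (0, 1)) ξ η = (2 * Real.pi * Complex.I * η) * fourier2 f ξ η := by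
  have hd : Differentiable ℝ f := hf.differentiable (by simp)
  have hder : ∀ x : ℝ, deriv (fun y : ℝ => f (x, y)) = fun y => fderiv ℝ f (x, y) (0, 1) := by
    intro x; ext y
    have h1 : HasDerivAt (fun y : ℝ => ((x, y) : ℝ × ℝ)) (0, 1) y :=
      (hasDerivAt_const y x).prodMk (hasDerivAt_id y)
    exact ((hd (x, y)).hasFDerivAt.comp_hasDerivAt y h1).deriv
  have hc' : Continuous (fun p => fderiv ℝ f p (0, 1)) :=
    (hf.continuous_fderiv (by simp)).clm_apply continuous_const
  have hs' := hs.fderiv_apply (𝕜 := ℝ) (0, 1)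
  have key : ∀ x : ℝ, 𝓕 (fun y : ℝ => fderiv ℝ f (x, y) (0, 1)) η
      = (2 * Real.pi * Complex.I * η) • 𝓕 (fun y : ℝ => f (x, y)) η := by
    intro x
    rw [← hder x, Real.fourier_deriv]
    · have := aux_slice_y hs x
      exact Continuous.integrable_of_hasCompactSupport (by have := hf.continuous; fun_prop) this
    · exact hd.comp (by fun_prop)
    · rw [hder x]
      exact Continuous.integrable_of_hasCompactSupport (by fun_prop) (aux_slice_y hs' x)
  rw [aux_fourier2_eq, aux_fourier2_eq]
  simp_rw [key]
  rw [Real.fourier_real_eq_integral_exp_smul, Real.fourier_real_eq_integral_exp_smul,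
    ← integral_const_mul]
  congr 1; ext x
  simp only [smul_eq_mul]; ring

lemma aux_Dx (f : ℝ × ℝ → ℂ) (hf : ContDiff ℝ (⊤ : ℕ∞) f) (hs : HasCompactSupport f) (ξ η : ℝ) :
    fourier2 (fun p => fderiv ℝ f p (1, 0)) ξ η = (2 * Real.pi * Complex.I * ξ) * fourier2 f ξ η := by
  have hc' : Continuous (fun p => fderiv ℝ f p (1, 0)) :=
    (hf.continuous_fderiv (by simp)).clm_apply continuous_const
  have hs' := hs.fderiv_apply (𝕜 := ℝ) (1, 0)
  have hsw : HasCompactSupport (fun p : ℝ × ℝ => f p.swap) :=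
      hs.comp_homeomorph (Homeomorph.prodComm ℝ ℝ)
  have hd : Differentiable ℝ f := hf.differentiable (by simp)
  rw [← aux_swap _ hc' hs', ← aux_swap f hf.continuous hs, ← aux_Dy (fun p => f p.swap) (hf.comp (contDiff_snd.prodMk contDiff_fst : ContDiff ℝ _ (fun p : ℝ × ℝ => p.swap))) hsw]
  congr 1
  ext p
  have h1 : HasFDerivAt (fun p : ℝ × ℝ => p.swap)
    ((ContinuousLinearMap.snd ℝ ℝ ℝ).prod (ContinuousLinearMap.fst ℝ ℝ ℝ)) p :=
    hasFDerivAt_snd.prodMk hasFDerivAt_fst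
  have h2 := (hd p.swap).hasFDerivAt.comp p h1
  have h3 := h2.fderiv
  simp only [Function.comp_def] at h3
  rw [h3]; simp

lemma aux_bound (f : ℝ × ℝ → ℂ) (hf : Continuous f) (hs : HasCompactSupport f) :
    ∃ C : ℝ, ∀ ξ η, ‖fourier2 f ξ η‖ ≤ C := by
  refine ⟨∫ x : ℝ, ∫ y : ℝ, ‖f (x, y)‖, fun ξ η => ?_⟩
  rw [aux_fourier2_eq]
  refine (VectorFourier.norm_fourierIntegral_le_integral_norm _ _ _ _ _).trans ?_
  have hi : Integrable f (volume.prod volume) := hf.integrable_of_hasCompactSupport hs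
  refine integral_mono_of_nonneg (Filter.Eventually.of_forall fun x => norm_nonneg _)
    hi.norm.integral_prod_left (Filter.Eventually.of_forall fun x => ?_)
  exact VectorFourier.norm_fourierIntegral_le_integral_norm _ _ _ _ _

lemma aux_decay (f : ℝ × ℝ → ℂ) (hf : ContDiff ℝ (⊤ : ℕ∞) f) (hs : HasCompactSupport f) :
    ∃ C : ℝ, ∀ ξ η : ℝ, ‖fourier2 f ξ η‖ ≤ C * ((1 + ξ ^ 2)⁻¹ * (1 + η ^ 2)⁻¹) := by
  have hD : ∀ (v : ℝ × ℝ) (g : ℝ × ℝ → ℂ), ContDiff ℝ (⊤ : ℕ∞) g →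
      ContDiff ℝ (⊤ : ℕ∞) (fun p => fderiv ℝ g p v) := fun v g hg =>
    (hg.fderiv_right (by simp)).clm_apply contDiff_const
  have hS : ∀ (v : ℝ × ℝ) (g : ℝ × ℝ → ℂ), HasCompactSupport g →
      HasCompactSupport (fun p => fderiv ℝ g p v) := fun v g hg => hg.fderiv_apply (𝕜 := ℝ) v
  have step : ∀ g : ℝ × ℝ → ℂ, ContDiff ℝ (⊤ : ℕ∞) g → HasCompactSupport g →
      ∃ C : ℝ, ∀ ξ η : ℝ, (1 + η ^ 2) * ‖fourier2 g ξ η‖ ≤ C := by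
    intro g hg hgs
    obtain ⟨C0, h0⟩ := aux_bound g hg.continuous hgs
    obtain ⟨C1, h1⟩ := aux_bound _ (hD (0,1) _ (hD (0,1) g hg)).continuous
      (hS (0,1) _ (hS (0,1) g hgs))
    refine ⟨C0 + C1, fun ξ η => ?_⟩
    have a0 := h0 ξ η
    have a1 := h1 ξ η
    rw [aux_Dy _ (hD (0,1) g hg) (hS (0,1) g hgs), aux_Dy _ hg hgs, ← mul_assoc, norm_mul] at a1
    have : η ^ 2 ≤ ‖(2 * Real.pi * Complex.I * η) * (2 * Real.pi * Complex.I * (η : ℂ))‖ := by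
      simp only [norm_mul, Complex.norm_I, Complex.norm_real, Real.norm_eq_abs,
        Complex.norm_ofNat, abs_of_pos Real.pi_pos]
      have := sq_abs η
      have h3 := Real.pi_gt_three
      have h4 : 0 ≤ η ^ 2 := sq_nonneg _
      have h5 : 1 ≤ 4 * Real.pi ^ 2 := by nlinarith
      have h6 := mul_le_mul_of_nonneg_right h5 h4
      have e : 2 * Real.pi * 1 * |η| * (2 * Real.pi * 1 * |η|) = 4 * Real.pi ^ 2 * η ^ 2 := by
        rw [← this]; ring
      rw [e]
      linarith
    nlinarith [norm_nonneg (fourier2 g ξ η), mul_le_mul_of_nonneg_right this (norm_nonneg (fourier2 g ξ η))]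
  obtain ⟨C0, h0⟩ := step f hf hs
  obtain ⟨C1, h1⟩ := step _ (hD (1,0) _ (hD (1,0) f hf)) (hS (1,0) _ (hS (1,0) f hs))
  refine ⟨C0 + C1, fun ξ η => ?_⟩
  have a0 := h0 ξ η
  have a1 := h1 ξ η
  rw [aux_Dx _ (hD (1,0) f hf) (hS (1,0) f hs), aux_Dx _ hf hs, ← mul_assoc, norm_mul] at a1
  have : ξ ^ 2 ≤ ‖(2 * Real.pi * Complex.I * ξ) * (2 * Real.pi * Complex.I * (ξ : ℂ))‖ := by
      simp only [norm_mul, Complex.norm_I, Complex.norm_real, Real.norm_eq_abs,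
        Complex.norm_ofNat, abs_of_pos Real.pi_pos]
      have := sq_abs ξ
      have h3 := Real.pi_gt_three
      have h4 : 0 ≤ ξ ^ 2 := sq_nonneg _
      have h5 : 1 ≤ 4 * Real.pi ^ 2 := by nlinarith
      have h6 := mul_le_mul_of_nonneg_right h5 h4
      have e : 2 * Real.pi * 1 * |ξ| * (2 * Real.pi * 1 * |ξ|) = 4 * Real.pi ^ 2 * ξ ^ 2 := by
        rw [← this]; ring
      rw [e]
      linarith
  have hξ : 0 < 1 + ξ ^ 2 := by positivity
  have hη : 0 < 1 + η ^ 2 := by positivity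
  rw [← mul_inv, ← div_eq_mul_inv, le_div_iff₀ (by positivity)]
  have hn : 0 ≤ (1 + η ^ 2) * ‖fourier2 f ξ η‖ := by positivity
  have := mul_le_mul_of_nonneg_right this hn
  nlinarith

lemma aux_summable_inv : Summable (fun n : ℤ => (1 + (n : ℝ) ^ 2)⁻¹) := by
  have h := Real.summable_abs_int_rpow (b := 2) one_lt_two
  refine Summable.of_norm_bounded_eventually h ?_
  rw [Filter.eventually_cofinite]
  refine (Set.finite_singleton (0 : ℤ)).subset fun n hn => ?_
  by_contra h0
  apply hn
  have h1 : (n : ℝ) ≠ 0 := by exact_mod_cast h0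
  rw [Real.norm_of_nonneg (by positivity), Real.rpow_neg (abs_nonneg _)]
  have : |(n : ℝ)| ^ (2 : ℝ) = (n : ℝ) ^ 2 := by rw [Real.rpow_two, sq_abs]
  rw [this]
  gcongr
  linarith

lemma aux_summable (f : ℝ × ℝ → ℂ) (hf : ContDiff ℝ (⊤ : ℕ∞) f) (hs : HasCompactSupport f) :
    Summable (fun p : ℤ × ℤ => fourier2 f p.1 p.2) := by
  obtain ⟨C, hC⟩ := aux_decay f hf hs
  refine Summable.of_norm_bounded ((aux_summable_inv.mul_of_nonneg aux_summable_inv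
    (fun n => by positivity) (fun n => by positivity)).mul_left C) fun p => hC _ _

lemma aux_slice_G (f : ℝ × ℝ → ℂ) (hf : Continuous f) (hs : HasCompactSupport f) (η : ℝ) :
    Continuous (fun x : ℝ => 𝓕 (fun y : ℝ => f (x, y)) η) ∧
    HasCompactSupport (fun x : ℝ => 𝓕 (fun y : ℝ => f (x, y)) η) := by
  constructor
  · simp_rw [Real.fourier_real_eq_integral_exp_smul]
    have hK : IsCompact (Prod.snd '' tsupport f) := hs.isCompact.image continuous_snd
    have := continuous_parametric_integral_of_continuous (μ := (volume : Measure ℝ))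
      (f := fun x y : ℝ => Complex.exp (↑(-2 * Real.pi * y * η) * Complex.I) • f (x, y))
      (by unfold Function.uncurry; fun_prop) hK
    refine this.congr fun x => ?_
    refine setIntegral_eq_integral_of_forall_compl_eq_zero fun y hy => ?_
    have : f (x, y) = 0 := by
      by_contra h
      exact hy ⟨(x, y), subset_tsupport _ h, rfl⟩
    simp [this]
  · refine HasCompactSupport.intro (hs.isCompact.image continuous_fst) fun x hx => ?_
    have : (fun y : ℝ => f (x, y)) = fun _ => 0 := by
      ext y
      by_contra h
      exact hx ⟨(x, y), subset_tsupport _ h, rfl⟩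
    rw [this, Real.fourier_real_eq_integral_exp_smul]; simp

lemma aux_poisson1 (h : ℝ → ℂ) (hc : Continuous h) (hs : HasCompactSupport h)
    (hF : Summable fun n : ℤ => 𝓕 h n) : ∑' n : ℤ, h n = ∑' n : ℤ, 𝓕 h n := by
  have h0 : h =ᶠ[Filter.cocompact ℝ] 0 := by
    rw [← Filter.coclosedCompact_eq_cocompact]
    exact hasCompactSupport_iff_eventuallyEq.mp hs
  have := Real.tsum_eq_tsum_fourier_of_rpow_decay_of_summable hc (b := 2) one_lt_two
    (h0.trans_isBigO (Asymptotics.isBigO_zero _ _)) hF 0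
  simpa using this

lemma aux_summable1 (h : ℝ → ℂ) (hc : ContDiff ℝ (⊤ : ℕ∞) h) (hs : HasCompactSupport h) :
    Summable fun n : ℤ => 𝓕 h n := by
  let g : SchwartzMap ℝ ℂ := hs.toSchwartzMap hc
  have h1 : (⇑(𝓕 g : SchwartzMap ℝ ℂ) : ℝ → ℂ) = 𝓕 h := by
    rw [SchwartzMap.fourier_coe]; rfl
  have := summable_of_isBigO (Real.summable_abs_int_rpow one_lt_two)
    (((𝓕 g : SchwartzMap ℝ ℂ).isBigO_cocompact_rpow (-2)).comp_tendsto Int.tendsto_coe_cofinite)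
  rw [h1] at this
  exact this

lemma aux_supp (f : ℝ × ℝ → ℂ) (hs : HasCompactSupport f) :
    ∃ N : ℕ, ∀ x y, f (x, y) ≠ 0 → |x| ≤ N ∧ |y| ≤ N := by
  obtain ⟨R, hR⟩ := hs.isCompact.isBounded.exists_norm_le
  obtain ⟨N, hN⟩ := exists_nat_ge R
  refine ⟨N, fun x y h => ?_⟩
  have := hR (x, y) (subset_tsupport _ h)
  rw [Prod.norm_def] at this
  simp only [Real.norm_eq_abs] at this
  exact ⟨(le_max_left _ _).trans (this.trans hN), (le_max_right _ _).trans (this.trans hN)⟩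

lemma aux_mem_Icc {m : ℤ} {N : ℕ} (h : |(m : ℝ)| ≤ N) : m ∈ Finset.Icc (-(N : ℤ)) N := by
  rw [Finset.mem_Icc, ← abs_le]
  exact_mod_cast h

lemma aux_summableZ (f : ℝ × ℝ → ℂ) (hs : HasCompactSupport f) :
    Summable (fun p : ℤ × ℤ => f ((p.1 : ℝ), (p.2 : ℝ))) := by
  obtain ⟨N, hN⟩ := aux_supp f hs
  refine summable_of_ne_finset_zero (s := Finset.Icc (-(N : ℤ)) N ×ˢ Finset.Icc (-(N : ℤ)) N)
    fun p hp => ?_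
  by_contra h
  have := hN _ _ h
  exact hp (Finset.mem_product.mpr ⟨aux_mem_Icc this.1, aux_mem_Icc this.2⟩)

lemma aux_poisson2 (f : ℝ × ℝ → ℂ) (hf : ContDiff ℝ (⊤ : ℕ∞) f) (hs : HasCompactSupport f) :
    ∑' p : ℤ × ℤ, f ((p.1 : ℝ), (p.2 : ℝ)) = ∑' p : ℤ × ℤ, fourier2 f p.1 p.2 := by
  obtain ⟨N, hN⟩ := aux_supp f hs
  have hsum := aux_summable f hf hs
  have hsl : ∀ x : ℝ, ContDiff ℝ (⊤ : ℕ∞) (fun y : ℝ => f (x, y)) := fun x =>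
    hf.comp (contDiff_const.prodMk contDiff_id)
  have hG : ∀ x : ℝ, Summable fun n : ℤ => 𝓕 (fun y : ℝ => f (x, y)) n := fun x =>
    aux_summable1 _ (hsl x) (aux_slice_y hs x)
  have hz : ∀ m : ℤ, m ∉ Finset.Icc (-(N : ℤ)) N → ∀ w : ℝ, 𝓕 (fun y : ℝ => f ((m : ℝ), y)) w = 0 := by
    intro m hm w
    have : (fun y : ℝ => f ((m : ℝ), y)) = fun _ => 0 := by
      ext y
      by_contra h
      exact hm (aux_mem_Icc (hN _ _ h).1)
    rw [this, Real.fourier_real_eq_integral_exp_smul]; simp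
  calc ∑' p : ℤ × ℤ, f ((p.1 : ℝ), (p.2 : ℝ))
      = ∑' m : ℤ, ∑' n : ℤ, f ((m : ℝ), (n : ℝ)) := (aux_summableZ f hs).tsum_prod
    _ = ∑' m : ℤ, ∑' n : ℤ, 𝓕 (fun y : ℝ => f ((m : ℝ), y)) n := by
        congr 1; ext m
        exact aux_poisson1 _ (hsl m).continuous (aux_slice_y hs m) (hG m)
    _ = ∑ m ∈ Finset.Icc (-(N : ℤ)) N, ∑' n : ℤ, 𝓕 (fun y : ℝ => f ((m : ℝ), y)) n :=
        tsum_eq_sum fun m hm => by simp [hz m hm]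
    _ = ∑' n : ℤ, ∑ m ∈ Finset.Icc (-(N : ℤ)) N, 𝓕 (fun y : ℝ => f ((m : ℝ), y)) n :=
        (Summable.tsum_finsetSum fun (m : ℤ) _ => hG (m : ℝ)).symm
    _ = ∑' n : ℤ, ∑' m : ℤ, 𝓕 (fun y : ℝ => f ((m : ℝ), y)) n := by
        congr 1; ext n
        exact (tsum_eq_sum fun m hm => hz m hm n).symm
    _ = ∑' n : ℤ, ∑' m : ℤ, fourier2 f m n := by
        congr 1; ext n
        obtain ⟨h1, h2⟩ := aux_slice_G f hf.continuous hs n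
        have h3 := aux_poisson1 _ h1 h2 (by
          have := hsum.prod_symm.prod_factor n
          simpa [aux_fourier2_eq] using this)
        simp_rw [aux_fourier2_eq]
        exact h3
    _ = ∑' p : ℤ × ℤ, fourier2 f p.1 p.2 := by
        rw [← (Equiv.prodComm ℤ ℤ).tsum_eq]
        exact hsum.prod_symm.tsum_prod.symm

lemma aux_affine1 (h : ℝ → ℂ) (x0 T w : ℝ) (hT : T ≠ 0) :
    𝓕 (fun x : ℝ => h (x0 + T * x)) w
      = ((|T|⁻¹ : ℝ) : ℂ) * Complex.exp (2 * Real.pi * Complex.I * w * x0 / T) * 𝓕 h (w / T) := by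
  rw [Real.fourier_real_eq_integral_exp_smul, Real.fourier_real_eq_integral_exp_smul]
  have hT' : (T : ℂ) ≠ 0 := by exact_mod_cast hT
  let k : ℝ → ℂ := fun u => Complex.exp (2 * Real.pi * Complex.I * w * x0 / T) *
    (Complex.exp (↑(-2 * Real.pi * u * (w / T)) * Complex.I) • h u)
  have e1 : ∀ v : ℝ, Complex.exp (↑(-2 * Real.pi * v * w) * Complex.I) • h (x0 + T * v)
      = (fun u => k (x0 + u)) (T * v) := by
    intro v
    simp only [k, smul_eq_mul]
    rw [← mul_assoc, ← Complex.exp_add]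
    congr 2
    push_cast
    field_simp
    ring
  simp_rw [e1]
  rw [Measure.integral_comp_mul_left (fun u => k (x0 + u)) T, integral_add_left_eq_self, integral_const_mul, abs_inv,
    Complex.real_smul, ← mul_assoc]

lemma aux_affine2 (f : ℝ × ℝ → ℂ) (x0 y0 T S ξ η : ℝ) (hT : T ≠ 0) (hS : S ≠ 0) :
    fourier2 (fun p => f (x0 + T * p.1, y0 + S * p.2)) ξ η
      = ((|T * S|⁻¹ : ℝ) : ℂ) * (Complex.exp (2 * Real.pi * Complex.I * ξ * x0 / T) *
        Complex.exp (2 * Real.pi * Complex.I * η * y0 / S)) * fourier2 f (ξ / T) (η / S) := by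
  rw [aux_fourier2_eq, aux_fourier2_eq]
  have e : ∀ x : ℝ, 𝓕 (fun y : ℝ => f (x0 + T * x, y0 + S * y)) η = _ := fun x =>
    aux_affine1 (fun y => f (x0 + T * x, y)) y0 S η hS
  simp only [e]
  rw [aux_affine1 (fun x => ((|S|⁻¹ : ℝ) : ℂ) * Complex.exp (2 * Real.pi * Complex.I * η * y0 / S)
    * 𝓕 (fun y => f (x, y)) (η / S)) x0 T ξ hT]
  have : 𝓕 (fun x : ℝ => ((|S|⁻¹ : ℝ) : ℂ) * Complex.exp (2 * Real.pi * Complex.I * η * y0 / S)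
    * 𝓕 (fun y => f (x, y)) (η / S)) (ξ / T) =
    ((|S|⁻¹ : ℝ) : ℂ) * Complex.exp (2 * Real.pi * Complex.I * η * y0 / S) *
      𝓕 (fun x : ℝ => 𝓕 (fun y => f (x, y)) (η / S)) (ξ / T) := by
    rw [Real.fourier_real_eq_integral_exp_smul, Real.fourier_real_eq_integral_exp_smul,
      ← integral_const_mul]
    congr 1; ext x; simp only [smul_eq_mul]; ring
  rw [this, abs_mul, mul_inv]
  push_cast
  ring

/-- The `k`-th residue class parametrization. -/
def auxJ (a b c : ℤ) (k : ℕ) (p : ℤ × ℤ) : ℤ × ℤ :=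
  ((b ^ 3 - 4 * a * b * c) + 8 * a ^ 2 * k + 96 * a ^ 3 * p.1, c ^ 2 - 3 * b * k + 12 * a * p.2)

lemma auxJ_inj (a b c : ℤ) (ha : a ≠ 0) (k : ℕ) : Function.Injective (auxJ a b c k) := by
  intro p q h
  simp only [auxJ, Prod.mk.injEq] at h
  obtain ⟨h1, h2⟩ := h
  have h1 := mul_left_cancel₀ (by positivity : 96 * a ^ 3 ≠ 0) (add_left_cancel h1)
  have h2 := mul_left_cancel₀ (by positivity : 12 * a ≠ 0) (add_left_cancel h2)
  exact Prod.ext h1 h2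

lemma auxJ_mem (a b c : ℤ) (ha : a ≠ 0) (k : ℕ) (p : ℤ × ℤ) : auxJ a b c k p ∈ Lam a b c := by
  have h8 : 8 * a ^ 2 ≠ 0 := by positivity
  have e : (auxJ a b c k p).1 - b ^ 3 + 4 * a * b * c = 8 * a ^ 2 * (k + 12 * a * p.1) := by
    simp only [auxJ]; ring
  refine ⟨⟨k + 12 * a * p.1, ?_⟩, ?_⟩
  · rw [← e]; ring
  · rw [e, Int.mul_ediv_cancel_left _ h8]
    exact ⟨p.2 + 3 * b * p.1, by simp only [auxJ]; ring⟩

lemma auxJ_cover (a b c : ℤ) (ha : a ≠ 0) (p : ℤ × ℤ) (hp : p ∈ Lam a b c) :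
    ∃ k0 ∈ Finset.range (12 * a.natAbs), ∀ k ∈ Finset.range (12 * a.natAbs),
      (p ∈ Set.range (auxJ a b c k) ↔ k = k0) := by
  have h8 : 8 * a ^ 2 ≠ 0 := by positivity
  have h12 : 12 * a ≠ 0 := by positivity
  obtain ⟨⟨q, hq⟩, h2⟩ := hp
  have e : p.1 - b ^ 3 + 4 * a * b * c = 8 * a ^ 2 * q := by rw [← hq]; ring
  rw [e, Int.mul_ediv_cancel_left _ h8] at h2
  obtain ⟨t, ht⟩ := h2
  have hq0 := Int.emod_nonneg q h12
  have hq1 := Int.emod_lt_abs q h12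
  have hq2 := Int.emod_add_mul_ediv q (12 * a)
  have hk0 : (((q % (12 * a)).toNat : ℕ) : ℤ) = q % (12 * a) := Int.toNat_of_nonneg hq0
  have habs : |12 * a| = ((12 * a.natAbs : ℕ) : ℤ) := by
    rw [abs_mul]; push_cast; simp
  refine ⟨(q % (12 * a)).toNat, ?_, fun k hk => ⟨?_, ?_⟩⟩
  · rw [Finset.mem_range]; zify; rw [hk0]
    rw [habs] at hq1; push_cast at hq1; exact hq1
  · rintro ⟨⟨m, n⟩, rfl⟩
    have h3 : 8 * a ^ 2 * (k + 12 * a * m) = 8 * a ^ 2 * q := by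
      rw [← hq]; simp only [auxJ]; ring
    have h4 := mul_left_cancel₀ h8 h3
    zify
    rw [hk0, ← h4, Int.add_mul_emod_self_left, ← Int.emod_abs, habs]
    rw [Finset.mem_range] at hk
    exact (Int.emod_eq_of_lt (by positivity) (by exact_mod_cast hk)).symm
  · rintro rfl
    refine ⟨(q / (12 * a), t - 3 * b * (q / (12 * a))), ?_⟩
    apply Prod.ext
    · simp only [auxJ, hk0]
      have : p.1 = b ^ 3 - 4 * a * b * c + 8 * a ^ 2 * q := by linarith
      rw [this]
      nth_rewrite 3 [← hq2]
      ring
    · simp only [auxJ, hk0]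
      have h5 : p.2 = 12 * a * t + c ^ 2 - 3 * b * q := by linarith
      rw [h5]
      nth_rewrite 3 [← hq2]
      ring

lemma aux_indicator (a b c : ℤ) (ha : a ≠ 0) (F : ℤ × ℤ → ℂ) (p : ℤ × ℤ) :
    Set.indicator (Lam a b c) F p =
      ∑ k ∈ Finset.range (12 * a.natAbs), Set.indicator (Set.range (auxJ a b c k)) F p := by
  by_cases hp : p ∈ Lam a b c
  · obtain ⟨k0, hk0, h⟩ := auxJ_cover a b c ha p hp
    rw [Set.indicator_of_mem hp, Finset.sum_eq_single_of_mem k0 hk0,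
      Set.indicator_of_mem ((h k0 hk0).2 rfl)]
    intro k hk hne
    exact Set.indicator_of_notMem (fun hh => hne ((h k hk).1 hh)) _
  · rw [Set.indicator_of_notMem hp, Finset.sum_eq_zero]
    intro k _
    refine Set.indicator_of_notMem ?_ _
    rintro ⟨q, rfl⟩
    exact hp (auxJ_mem a b c ha k q)

/-- Twisted Poisson summation over the lattice set `Λ_{(a,b,c)}`: for a smooth,
compactly supported `f : ℝ² → ℂ`, the sum of `f` over `Λ_{(a,b,c)}` equals
`Σ_{(α,β) ∈ ℤ²} ψ̂(α,β) f̂(α/(96a³), β/(12a))`, the right-hand side converging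
absolutely. -/
theorem twisted_poisson_summation (a b c : ℤ) (ha : a ≠ 0) (f : ℝ × ℝ → ℂ)
    (hf : ContDiff ℝ (⊤ : ℕ∞) f) (hsupp : HasCompactSupport f) :
    Summable (fun p : ℤ × ℤ =>
      ‖psihat a b c p.1 p.2 *
        fourier2 f ((p.1 : ℝ) / (96 * (a : ℝ) ^ 3)) ((p.2 : ℝ) / (12 * (a : ℝ)))‖) ∧
    (∑' p : ℤ × ℤ, Set.indicator (Lam a b c) (fun q => f ((q.1 : ℝ), (q.2 : ℝ))) p) =
      ∑' p : ℤ × ℤ, psihat a b c p.1 p.2 *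
        fourier2 f ((p.1 : ℝ) / (96 * (a : ℝ) ^ 3)) ((p.2 : ℝ) / (12 * (a : ℝ))) := by
  classical
  have haR : (a : ℝ) ≠ 0 := by exact_mod_cast ha
  have haC : (a : ℂ) ≠ 0 := by exact_mod_cast ha
  have hT : 96 * (a : ℝ) ^ 3 ≠ 0 := by positivity
  have hS : 12 * (a : ℝ) ≠ 0 := by positivity
  let X : ℕ → ℝ := fun k => ((b ^ 3 - 4 * a * b * c : ℤ) : ℝ) + 8 * (a : ℝ) ^ 2 * k
  let Y : ℕ → ℝ := fun k => (c : ℝ) ^ 2 - 3 * b * k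
  let g : ℕ → ℝ × ℝ → ℂ := fun k p => f (X k + 96 * (a : ℝ) ^ 3 * p.1, Y k + 12 * (a : ℝ) * p.2)
  have hg : ∀ k, ContDiff ℝ (⊤ : ℕ∞) (g k) := fun k => hf.comp (by fun_prop)
  have hgs : ∀ k, HasCompactSupport (g k) := fun k => by
    let e : ℝ × ℝ ≃ₜ ℝ × ℝ :=
      ((Homeomorph.mulLeft₀ _ hT).trans (Homeomorph.addLeft (X k))).prodCongr
        ((Homeomorph.mulLeft₀ _ hS).trans (Homeomorph.addLeft (Y k)))
    exact hsupp.comp_homeomorph e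
  have hpsi : ∀ p : ℤ × ℤ, psihat a b c p.1 p.2 *
        fourier2 f ((p.1 : ℝ) / (96 * (a : ℝ) ^ 3)) ((p.2 : ℝ) / (12 * (a : ℝ)))
      = ∑ k ∈ Finset.range (12 * a.natAbs), fourier2 (g k) p.1 p.2 := by
    intro p
    unfold psihat
    rw [mul_assoc, Finset.sum_mul, Finset.mul_sum]
    refine Finset.sum_congr rfl fun k _ => ?_
    simp only [g]
    rw [aux_affine2 f _ _ _ _ _ _ hT hS]
    have habs : |96 * (a : ℝ) ^ 3 * (12 * (a : ℝ))| = 8 * (a : ℝ) ^ 2 * (12 * a) * (12 * a) := by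
      have : 96 * (a : ℝ) ^ 3 * (12 * (a : ℝ)) = 8 * (a : ℝ) ^ 2 * (12 * a) * (12 * a) := by ring
      rw [this, abs_of_nonneg]
      have : 8 * (a : ℝ) ^ 2 * (12 * a) * (12 * a) = 1152 * (a ^ 2) ^ 2 := by ring
      rw [this]; positivity
    rw [habs]
    simp only [X, Y]
    push_cast
    rw [one_div]
    ring
  have hsumk : ∀ k, Summable fun p : ℤ × ℤ => fourier2 (g k) p.1 p.2 := fun k =>
    aux_summable (g k) (hg k) (hgs k)
  constructor
  · simp_rw [hpsi]
    exact (summable_sum fun k _ => hsumk k).norm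
  · simp_rw [hpsi]
    rw [Summable.tsum_finsetSum fun k _ => hsumk k]
    simp_rw [aux_indicator a b c ha]
    rw [Summable.tsum_finsetSum fun k _ => (aux_summableZ f hsupp).indicator _]
    refine Finset.sum_congr rfl fun k _ => ?_
    rw [← aux_poisson2 (g k) (hg k) (hgs k),
      ← (auxJ_inj a b c ha k).tsum_eq Set.support_indicator_subset]
    congr 1; ext p
    rw [Set.indicator_of_mem (Set.mem_range_self p)]
    simp only [g, auxJ, X, Y]
    push_cast
    rfl
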